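/- Let E be a complete geodesic space with convex metric and let f:E→ℝ be continuous, convex, bounded below on bounded sets, and satisfying one of: (i) inf_{x∈E} f(x) = −∞, or (ii) there exists z₀∈E with f(z₀) = inf_{x∈E} f(x) and every sequence (x_n) in E with f(x_n)→f(z₀) converges to z₀. Then the set W_min = { X ∈ P_{b,cl,cv}(E) : min(X,f) is well-posed in the sense of Revalski } is a dense G_δ-set in the metric space (P_{b,cl,cv}(E), h). -/

import Mathlib

open Metric Set Filter Bornology

noncomputable section

/-- A geodesic path of length `l`: a map `c : ℝ → E` that is isometric on `[0, l]`. -/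
def IsGeodesicPath {E : Type*} [MetricSpace E] (c : ℝ → E) (l : ℝ) : Prop :=
  0 ≤ l ∧ ∀ s ∈ Icc (0:ℝ) l, ∀ t ∈ Icc (0:ℝ) l, dist (c s) (c t) = |s - t|

/-- `S` is a geodesic segment joining `x` and `y`. -/
def IsGeodesicSegment {E : Type*} [MetricSpace E] (S : Set E) (x y : E) : Prop :=
  ∃ c l, IsGeodesicPath c l ∧ c 0 = x ∧ c l = y ∧ S = c '' Icc (0:ℝ) l

/-- A geodesic (line): an isometric image of `ℝ`. -/
def IsGeodesicLine {E : Type*} [MetricSpace E] (S : Set E) : Prop :=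
  ∃ c : ℝ → E, Isometry c ∧ S = Set.range c

/-- `E` is a geodesic space: every two points are joined by a geodesic path. -/
def IsGeodesicSpace (E : Type*) [MetricSpace E] : Prop :=
  ∀ x y : E, ∃ S, IsGeodesicSegment S x y

/-- `E` has the geodesic extension property: every geodesic segment is contained
in a geodesic. -/
def GeodesicExtensionProperty (E : Type*) [MetricSpace E] : Prop :=
  ∀ (S : Set E) (x y : E), IsGeodesicSegment S x y → ∃ L, IsGeodesicLine L ∧ S ⊆ L

/-- The metric of `E` is convex. -/
def HasConvexMetric (E : Type*) [MetricSpace E] : Prop :=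
  ∀ (c₁ c₂ : ℝ → E) (l₁ l₂ : ℝ), IsGeodesicPath c₁ l₁ → IsGeodesicPath c₂ l₂ →
    ∀ t ∈ Icc (0:ℝ) 1,
      dist (c₁ (t * l₁)) (c₂ (t * l₂)) ≤
        (1 - t) * dist (c₁ 0) (c₂ 0) + t * dist (c₁ l₁) (c₂ l₂)

/-- A subset `X` is (geodesically) convex: any geodesic segment joining two points
of `X` is contained in `X`. -/
def GeodesicConvex {E : Type*} [MetricSpace E] (X : Set E) : Prop :=
  ∀ x ∈ X, ∀ y ∈ X, ∀ S : Set E, IsGeodesicSegment S x y → S ⊆ X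

/-- A function `f : E → ℝ` is (geodesically) convex. -/
def GeodesicConvexFun {E : Type*} [MetricSpace E] (f : E → ℝ) : Prop :=
  ∀ (c : ℝ → E) (l : ℝ), IsGeodesicPath c l → ∀ t ∈ Icc (0:ℝ) 1,
    f (c (t * l)) ≤ (1 - t) * f (c 0) + t * f (c l)

/-- `G₁(S)`: the union of all geodesic segments with endpoints in `S`. -/
def geodSegUnion {E : Type*} [MetricSpace E] (S : Set E) : Set E :=
  {z | ∃ x ∈ S, ∃ y ∈ S, ∃ T : Set E, IsGeodesicSegment T x y ∧ z ∈ T}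

/-- The iterates `G_n(S)`. -/
def geodGn {E : Type*} [MetricSpace E] (S : Set E) : ℕ → Set E
  | 0 => S
  | n + 1 => geodSegUnion (geodGn S n)

/-- The (geodesic) convex hull `co(S) = ⋃ₙ G_n(S)`. -/
def geodConvexHull {E : Type*} [MetricSpace E] (S : Set E) : Set E :=
  ⋃ n, geodGn S n

/-- `E` is without bifurcating geodesics. -/
def NoBifurcatingGeodesics (E : Type*) [MetricSpace E] : Prop :=
  ∀ (p a b : E) (S₁ S₂ : Set E), IsGeodesicSegment S₁ p a → IsGeodesicSegment S₂ p b →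
    ∀ z, z ∈ S₁ → z ∈ S₂ → z ≠ p → (z = a ∧ z = b) ∨ S₁ ⊆ S₂ ∨ S₂ ⊆ S₁

/-- `E` is reflexive: every descending sequence of nonempty, bounded, closed and convex
subsets of `E` has nonempty intersection. -/
def ReflexiveGeodesicSpace (E : Type*) [MetricSpace E] : Prop :=
  ∀ C : ℕ → Set E, (∀ n, (C n).Nonempty) → (∀ n, IsBounded (C n)) → (∀ n, IsClosed (C n)) →
    (∀ n, GeodesicConvex (C n)) → (∀ n, C (n + 1) ⊆ C n) → (⋂ n, C n).Nonempty

/-- `Dist(x, A)`: the remotal (farthest) distance from `x` to `A`. -/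
def supDist {E : Type*} [MetricSpace E] (x : E) (A : Set E) : ℝ :=
  sSup ((fun a => dist x a) '' A)

/-- `λ_{XY} = inf{ d(x,y) : x ∈ X, y ∈ Y }`. -/
def infSetDist {E : Type*} [MetricSpace E] (X Y : Set E) : ℝ :=
  sInf (Set.image2 dist X Y)

/-- `μ_{XY} = sup{ d(x,y) : x ∈ X, y ∈ Y }`. -/
def supSetDist {E : Type*} [MetricSpace E] (X Y : Set E) : ℝ :=
  sSup (Set.image2 dist X Y)

/-- `L_{XY}(σ) = { x ∈ X : dist(x,Y) ≤ λ_{XY} + σ }`. -/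
def Lset {E : Type*} [MetricSpace E] (X Y : Set E) (σ : ℝ) : Set E :=
  {x ∈ X | infDist x Y ≤ infSetDist X Y + σ}

/-- `M_{XY}(σ) = { x ∈ X : Dist(x,Y) ≥ μ_{XY} − σ }`. -/
def Mset {E : Type*} [MetricSpace E] (X Y : Set E) (σ : ℝ) : Set E :=
  {x ∈ X | supSetDist X Y - σ ≤ supDist x Y}

/-- The minimization problem `min(X,Y)` is well-posed. -/
def MinWellPosed {E : Type*} [MetricSpace E] (X Y : Set E) : Prop :=
  ∃ x₀ ∈ X, ∃ y₀ ∈ Y, dist x₀ y₀ = infSetDist X Y ∧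
    (∀ x ∈ X, ∀ y ∈ Y, dist x y = infSetDist X Y → x = x₀ ∧ y = y₀) ∧
    ∀ x : ℕ → E, ∀ y : ℕ → E, (∀ n, x n ∈ X) → (∀ n, y n ∈ Y) →
      Tendsto (fun n => dist (x n) (y n)) atTop (nhds (infSetDist X Y)) →
      Tendsto x atTop (nhds x₀) ∧ Tendsto y atTop (nhds y₀)

/-- The maximization problem `max(X,Y)` is well-posed. -/
def MaxWellPosed {E : Type*} [MetricSpace E] (X Y : Set E) : Prop :=
  ∃ x₀ ∈ X, ∃ y₀ ∈ Y, dist x₀ y₀ = supSetDist X Y ∧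
    (∀ x ∈ X, ∀ y ∈ Y, dist x y = supSetDist X Y → x = x₀ ∧ y = y₀) ∧
    ∀ x : ℕ → E, ∀ y : ℕ → E, (∀ n, x n ∈ X) → (∀ n, y n ∈ Y) →
      Tendsto (fun n => dist (x n) (y n)) atTop (nhds (supSetDist X Y)) →
      Tendsto x atTop (nhds x₀) ∧ Tendsto y atTop (nhds y₀)

/-- The distance of the model space `M²_κ` (κ < 0): the hyperbolic distance
multiplied by `1/√(-κ)`. -/
def kdist (κ : ℝ) (a b : UpperHalfPlane) : ℝ :=
  (Real.sqrt (-κ))⁻¹ * dist a b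

/-- `pb` is the comparison point in `M²_κ` (relative to the side from `xi` to `xj`,
with comparison vertices `xib`, `xjb`) of a point `p` on a geodesic segment from
`xi` to `xj`. -/
def IsComparisonPoint {E : Type*} [MetricSpace E] (κ : ℝ) (xi xj : E)
    (xib xjb : UpperHalfPlane) (p : E) (pb : UpperHalfPlane) : Prop :=
  kdist κ xib pb = dist xi p ∧ kdist κ pb xjb = dist p xj

/-- `E` has curvature bounded below by `κ < 0`: every geodesic triangle satisfies the
reversed CAT(κ) inequality with respect to any κ-comparison triangle in `M²_κ`. -/
def CurvBoundedBelow (E : Type*) [MetricSpace E] (κ : ℝ) : Prop :=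
  ∀ (x₁ x₂ x₃ : E) (S₁₂ S₂₃ S₁₃ : Set E),
    IsGeodesicSegment S₁₂ x₁ x₂ → IsGeodesicSegment S₂₃ x₂ x₃ → IsGeodesicSegment S₁₃ x₁ x₃ →
    ∀ x₁b x₂b x₃b : UpperHalfPlane,
      kdist κ x₁b x₂b = dist x₁ x₂ → kdist κ x₂b x₃b = dist x₂ x₃ →
      kdist κ x₁b x₃b = dist x₁ x₃ →
      ∀ (p q : E) (pb qb : UpperHalfPlane),
        ((p ∈ S₁₂ ∧ IsComparisonPoint κ x₁ x₂ x₁b x₂b p pb) ∨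
         (p ∈ S₂₃ ∧ IsComparisonPoint κ x₂ x₃ x₂b x₃b p pb) ∨
         (p ∈ S₁₃ ∧ IsComparisonPoint κ x₁ x₃ x₁b x₃b p pb)) →
        ((q ∈ S₁₂ ∧ IsComparisonPoint κ x₁ x₂ x₁b x₂b q qb) ∨
         (q ∈ S₂₃ ∧ IsComparisonPoint κ x₂ x₃ x₂b x₃b q qb) ∨
         (q ∈ S₁₃ ∧ IsComparisonPoint κ x₁ x₃ x₁b x₃b q qb)) →
        kdist κ pb qb ≤ dist p q

/-- Comparison points for Euclidean (κ = 0) comparison triangles in `ℝ²`. -/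
def IsComparisonPointE {E : Type*} [MetricSpace E] (xi xj : E)
    (xib xjb : EuclideanSpace ℝ (Fin 2)) (p : E) (pb : EuclideanSpace ℝ (Fin 2)) : Prop :=
  dist xib pb = dist xi p ∧ dist pb xjb = dist p xj

/-- `E` is a CAT(0) space: a geodesic space where every geodesic triangle satisfies the
CAT(0) comparison inequality with respect to Euclidean comparison triangles. -/
def CATZero (E : Type*) [MetricSpace E] : Prop :=
  IsGeodesicSpace E ∧
  ∀ (x₁ x₂ x₃ : E) (S₁₂ S₂₃ S₁₃ : Set E),
    IsGeodesicSegment S₁₂ x₁ x₂ → IsGeodesicSegment S₂₃ x₂ x₃ → IsGeodesicSegment S₁₃ x₁ x₃ →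
    ∀ x₁b x₂b x₃b : EuclideanSpace ℝ (Fin 2),
      dist x₁b x₂b = dist x₁ x₂ → dist x₂b x₃b = dist x₂ x₃ → dist x₁b x₃b = dist x₁ x₃ →
      ∀ (p q : E) (pb qb : EuclideanSpace ℝ (Fin 2)),
        ((p ∈ S₁₂ ∧ IsComparisonPointE x₁ x₂ x₁b x₂b p pb) ∨
         (p ∈ S₂₃ ∧ IsComparisonPointE x₂ x₃ x₂b x₃b p pb) ∨
         (p ∈ S₁₃ ∧ IsComparisonPointE x₁ x₃ x₁b x₃b p pb)) →
        ((q ∈ S₁₂ ∧ IsComparisonPointE x₁ x₂ x₁b x₂b q qb) ∨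
         (q ∈ S₂₃ ∧ IsComparisonPointE x₂ x₃ x₂b x₃b q qb) ∨
         (q ∈ S₁₃ ∧ IsComparisonPointE x₁ x₃ x₁b x₃b q qb)) →
        dist p q ≤ dist pb qb

/-- The space `P_{b,cl,cv}(E)` of nonempty, bounded, closed and convex subsets of `E`. -/
def Pbclcv (E : Type*) [MetricSpace E] : Type _ :=
  {X : Set E // X.Nonempty ∧ IsBounded X ∧ IsClosed X ∧ GeodesicConvex X}

/-- `P_{b,cl,cv}(E)` carries the Pompeiu-Hausdorff distance. -/
instance Pbclcv.metricSpace (E : Type*) [MetricSpace E] : MetricSpace (Pbclcv E) where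
  dist X Y := hausdorffDist X.1 Y.1
  dist_self X := hausdorffDist_self_zero
  dist_comm X Y := hausdorffDist_comm
  dist_triangle X Y Z := hausdorffDist_triangle
    (hausdorffEdist_ne_top_of_nonempty_of_bounded X.2.1 Y.2.1 X.2.2.1 Y.2.2.1)
  eq_of_dist_eq_zero := by
    intro X Y h
    exact Subtype.ext ((X.2.2.2.1.hausdorffDist_zero_iff_eq Y.2.2.2.1
      (hausdorffEdist_ne_top_of_nonempty_of_bounded X.2.1 Y.2.1 X.2.2.1 Y.2.2.1)).mp h)

/-- `P^A_{b,cl,cv}(E)`: the closure in `(P_{b,cl,cv}(E), h)` of the family of sets at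
positive distance from `A`. -/
def PAbclcv {E : Type*} [MetricSpace E] (A : Set E) : Set (Pbclcv E) :=
  closure {X : Pbclcv E | 0 < infSetDist X.1 A}

/-- The inverse hyperbolic cosine. -/
def arcosh (x : ℝ) : ℝ := Real.log (x + Real.sqrt (x ^ 2 - 1))

/-- The function `F_κ`. -/
def Fkappa (κ d r σ : ℝ) : ℝ :=
  2 / Real.sqrt (-κ) *
    arcosh (Real.cosh (Real.sqrt (-κ) * (r - d + σ)) ^ 2 -
      Real.sinh (Real.sqrt (-κ) * (r - d + σ)) / Real.sinh (Real.sqrt (-κ) * d) *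
        (Real.cosh (Real.sqrt (-κ) * r) -
          Real.cosh (Real.sqrt (-κ) * d) * Real.cosh (Real.sqrt (-κ) * (r - d + σ))))

/-- The petal `P_{α,δ}(x₀, f)`. -/
def petal {E : Type*} [MetricSpace E] (f : E → ℝ) (α δ : ℝ) (x₀ : E) : Set E :=
  {x | f x ≤ f x₀ - α * dist x x₀ + δ}

/-- `L_{A,f}(σ)`. -/
def LsetFun {E : Type*} [MetricSpace E] (A : Set E) (f : E → ℝ) (σ : ℝ) : Set E :=
  {x | f x ≤ sInf (f '' A) + σ ∧ infDist x A ≤ σ}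

/-- The problem `min(A,f)` is well-posed in the sense of Revalski. -/
def RevalskiWellPosed {E : Type*} [MetricSpace E] (A : Set E) (f : E → ℝ) : Prop :=
  sInf ((fun σ => diam (LsetFun A f σ)) '' Ioi 0) = 0

/-- The nearest point problem `min(X,y)` is well-posed. -/
def PointMinWellPosed {E : Type*} [MetricSpace E] (X : Set E) (y : E) : Prop :=
  ∃ x₀ ∈ X, dist x₀ y = infDist y X ∧ (∀ x ∈ X, dist x y = infDist y X → x = x₀) ∧
    ∀ x : ℕ → E, (∀ n, x n ∈ X) →
      Tendsto (fun n => dist (x n) y) atTop (nhds (infDist y X)) →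
      Tendsto x atTop (nhds x₀)

end

/-- Ekeland's variational principle for a continuous function on a closed set. -/
theorem exists_ekeland_point {E : Type*} [MetricSpace E] [CompleteSpace E] {S : Set E}
    (hS : IsClosed S) {g : E → ℝ} (hg : Continuous g) (hb : BddBelow (g '' S)) {α : ℝ}
    (hα : 0 < α) {x : E} (hx : x ∈ S) :
    ∃ y ∈ S, g y ≤ g x ∧ ∀ q ∈ S, g y - α * dist q y ≤ g q := by
  let T : E → Set E := fun y => {q ∈ S | g q + α * dist q y ≤ g y}
  have self_mem : ∀ y ∈ S, y ∈ T y := fun y hy => ⟨hy, by simp⟩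
  have trans : ∀ {a b c}, a ∈ T b → b ∈ T c → a ∈ T c := by
    rintro a b c ⟨ha, hab⟩ ⟨-, hbc⟩
    refine ⟨ha, ?_⟩
    nlinarith [dist_triangle a b c]
  have bdd : ∀ y, BddBelow (g '' T y) := fun y => hb.mono (image_mono fun q hq => hq.1)
  have step : ∀ (n : ℕ) (y : S), ∃ y' : S, (y' : E) ∈ T y ∧
      ∀ q ∈ T y, g y' ≤ g q + α * (1 / 2) ^ n := by
    intro n y
    have hpos : 0 < α * (1 / 2 : ℝ) ^ n := by positivity
    obtain ⟨_, ⟨y', hy', rfl⟩, hlt⟩ := exists_lt_of_csInf_lt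
      (Set.Nonempty.image g ⟨y.1, self_mem y y.2⟩) (lt_add_of_pos_right (sInf (g '' T y)) hpos)
    refine ⟨⟨y', hy'.1⟩, hy', fun q hq => ?_⟩
    have := csInf_le (bdd y) (mem_image_of_mem g hq)
    change g y' ≤ _
    linarith
  choose next hnext hmin using step
  let u : ℕ → S := fun n => Nat.rec ⟨x, hx⟩ (fun k y => next k y) n
  have hu : ∀ n, u (n + 1) = next n (u n) := fun n => rfl
  have hmono : ∀ n k : ℕ, (u (n + k)).1 ∈ T (u n).1 := by
    intro n k
    induction k with
    | zero => exact self_mem _ (u n).2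
    | succ k ih => exact trans (by rw [← add_assoc, hu]; exact hnext _ _) ih
  have hsmall : ∀ n : ℕ, ∀ q ∈ T (u (n + 1)).1, dist q (u (n + 1)) ≤ (1 / 2) ^ n := by
    intro n q hq
    have h1 := hmin n (u n) q (trans hq (hmono n 1))
    rw [← hu] at h1
    have h2 := hq.2
    exact le_of_mul_le_mul_left (by linarith) hα
  have hcau : CauchySeq fun n => (u (n + 1) : E) := by
    refine cauchySeq_of_le_geometric (1 / 2) 1 (by norm_num) fun n => ?_
    rw [dist_comm, one_mul]
    exact hsmall n _ (hmono (n + 1) 1)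
  obtain ⟨y, hy⟩ := cauchySeq_tendsto_of_complete hcau
  have hyS : y ∈ S := hS.mem_of_tendsto hy (Eventually.of_forall fun n => (u (n + 1)).2)
  have hyT : ∀ n, y ∈ T (u n).1 := by
    intro n
    refine ⟨hyS, ?_⟩
    have hc : Continuous fun q => g q + α * dist q (u n).1 := by fun_prop
    refine le_of_tendsto ((hc.tendsto y).comp hy) ?_
    filter_upwards [eventually_ge_atTop n] with k hk
    obtain ⟨j, rfl⟩ := Nat.exists_eq_add_of_le hk
    exact (hmono n (j + 1)).2
  refine ⟨y, hyS, ?_, fun q hq => ?_⟩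
  · have : g y + α * dist y x ≤ g x := (hyT 0).2
    nlinarith [dist_nonneg (x := y) (y := x)]
  · by_contra! hlt
    have hqT : q ∈ T y := ⟨hq, by linarith⟩
    have hlim : Tendsto (fun n => (u (n + 1) : E)) atTop (nhds q) := by
      rw [tendsto_iff_dist_tendsto_zero]
      refine squeeze_zero (fun _ => dist_nonneg)
        (fun n => by rw [dist_comm]; exact hsmall n q (trans hqT (hyT (n + 1))))
        (tendsto_pow_atTop_nhds_zero_of_lt_one (by norm_num) (by norm_num))
    obtain rfl := tendsto_nhds_unique hlim hy
    simp at hlt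

section

variable {E : Type*} [MetricSpace E]

theorem isGeodesicPath_const (y : E) : IsGeodesicPath (fun _ => y) 0 := by
  refine ⟨le_rfl, fun s hs t ht => ?_⟩
  simp only [Icc_self, mem_singleton_iff] at hs ht
  simp [hs, ht]

theorem IsGeodesicSpace.exists_path (hgeo : IsGeodesicSpace E) (x y : E) :
    ∃ c l, IsGeodesicPath c l ∧ c 0 = x ∧ c l = y := by
  obtain ⟨_, c, l, hc, h0, hl, -⟩ := hgeo x y
  exact ⟨c, l, hc, h0, hl⟩

theorem mul_mem_Icc_of_mem_unit {t l : ℝ} (ht : t ∈ Icc (0 : ℝ) 1) (hl : 0 ≤ l) :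
    t * l ∈ Icc 0 l :=
  ⟨mul_nonneg ht.1 hl, mul_le_of_le_one_left hl ht.2⟩

theorem HasConvexMetric.geodesicConvexFun_dist (hconv : HasConvexMetric E) (y : E) :
    GeodesicConvexFun fun x => dist x y :=
  fun c l hc t ht => by simpa using hconv c (fun _ => y) l 0 hc (isGeodesicPath_const y) t ht

theorem HasConvexMetric.geodesicConvexFun_infDist (hgeo : IsGeodesicSpace E)
    (hconv : HasConvexMetric E) {X : Set E} (hne : X.Nonempty) (hX : GeodesicConvex X) :
    GeodesicConvexFun fun x => infDist x X := by
  intro c l hc t ht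
  refine le_of_forall_pos_le_add fun ε hε => ?_
  obtain ⟨a, ha, hda⟩ := (infDist_lt_iff hne).1 (lt_add_of_pos_right (infDist (c 0) X) hε)
  obtain ⟨b, hb, hdb⟩ := (infDist_lt_iff hne).1 (lt_add_of_pos_right (infDist (c l) X) hε)
  obtain ⟨c', l', hc', rfl, rfl⟩ := hgeo.exists_path a b
  have hmem : c' (t * l') ∈ X :=
    hX _ ha _ hb _ ⟨c', l', hc', rfl, rfl, rfl⟩
      (mem_image_of_mem c' (mul_mem_Icc_of_mem_unit ht hc'.1))
  have h1 := infDist_le_dist_of_mem (x := c (t * l)) hmem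
  have h2 := hconv c c' l l' hc hc' t ht
  nlinarith [mul_le_mul_of_nonneg_left hda.le (sub_nonneg.2 ht.2),
    mul_le_mul_of_nonneg_left hdb.le ht.1]

theorem GeodesicConvexFun.geodesicConvex_sublevel {g : E → ℝ} (hg : GeodesicConvexFun g) (a : ℝ) :
    GeodesicConvex {x | g x ≤ a} := by
  rintro x hx y hy _ ⟨c, l, hc, rfl, rfl, rfl⟩ _ ⟨s, hs, rfl⟩
  obtain ⟨t, ht, rfl⟩ : ∃ t ∈ Icc (0 : ℝ) 1, s = t * l := by
    rcases hc.1.eq_or_lt with h | h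
    · subst h
      exact ⟨0, by simp, by simpa using hs⟩
    · exact ⟨s / l, ⟨div_nonneg hs.1 h.le, (div_le_one h).2 hs.2⟩, by field_simp⟩
  have h1 := hg c l hc t ht
  simp only [mem_ofPred_eq] at hx hy ⊢
  nlinarith [mul_le_mul_of_nonneg_left hx (sub_nonneg.2 ht.2), mul_le_mul_of_nonneg_left hy ht.1]

theorem GeodesicConvexFun.mul_add {g k : E → ℝ} (hg : GeodesicConvexFun g)
    (hk : GeodesicConvexFun k) {a : ℝ} (ha : 0 ≤ a) :
    GeodesicConvexFun fun x => a * g x + k x := by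
  intro c l hc t ht
  have h1 := mul_le_mul_of_nonneg_left (hg c l hc t ht) ha
  have h2 := hk c l hc t ht
  simp only
  linarith

theorem isBounded_infDist_le {X : Set E} (hne : X.Nonempty) (hb : IsBounded X) (r : ℝ) :
    IsBounded {x | infDist x X ≤ r} := by
  refine (hb.thickening (δ := r + 1)).subset fun x hx => ?_
  rw [mem_thickening_iff_infDist_lt hne]
  exact lt_of_le_of_lt hx (lt_add_one r)

theorem isBounded_LsetFun {X : Set E} (hne : X.Nonempty) (hb : IsBounded X) (f : E → ℝ) (σ : ℝ) :
    IsBounded (LsetFun X f σ) :=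
  (isBounded_infDist_le hne hb σ).subset fun _ hx => hx.2

theorem revalskiWellPosed_iff {X : Set E} {f : E → ℝ} :
    RevalskiWellPosed X f ↔ ∀ η > 0, ∃ σ > 0, diam (LsetFun X f σ) < η := by
  have hne : ((fun σ => diam (LsetFun X f σ)) '' Ioi 0).Nonempty := nonempty_Ioi.image _
  constructor
  · intro h η hη
    obtain ⟨_, ⟨σ, hσ, rfl⟩, hlt⟩ := exists_lt_of_csInf_lt hne (h.trans_lt hη)
    exact ⟨σ, hσ, hlt⟩
  · intro h
    refine le_antisymm (le_of_forall_pos_le_add fun η hη => ?_) (Real.sInf_nonneg ?_)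
    · obtain ⟨σ, hσ, hlt⟩ := h η hη
      refine (csInf_le ⟨0, ?_⟩ (mem_image_of_mem _ hσ)).trans (by simpa using hlt.le)
      rintro _ ⟨_, -, rfl⟩
      exact diam_nonneg
    · rintro _ ⟨_, -, rfl⟩
      exact diam_nonneg

theorem revalskiWellPosed_of_dist_le {X : Set E} {f : E → ℝ} (y : E)
    (h : ∀ η > 0, ∃ σ > 0, ∀ p ∈ LsetFun X f σ, dist p y ≤ η) : RevalskiWellPosed X f := by
  refine revalskiWellPosed_iff.2 fun η hη => ?_
  obtain ⟨σ, hσ, hp⟩ := h (η / 4) (by positivity)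
  refine ⟨σ, hσ, (diam_mono (s := LsetFun X f σ) (t := closedBall y (η / 4)) hp
    isBounded_closedBall).trans_lt ((diam_closedBall (by positivity)).trans_lt (by linarith))⟩

theorem Pbclcv.hausdorffEDist_ne_top (X Y : Pbclcv E) : hausdorffEDist X.1 Y.1 ≠ ⊤ :=
  hausdorffEDist_ne_top_of_nonempty_of_bounded X.2.1 Y.2.1 X.2.2.1 Y.2.2.1

theorem isOpen_exists_diam_LsetFun_lt {f : E → ℝ} (hfc : Continuous f)
    (hbdd : ∀ S : Set E, IsBounded S → BddBelow (f '' S)) (η : ℝ) :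
    IsOpen {X : Pbclcv E | ∃ σ > 0, diam (LsetFun X.1 f σ) < η} := by
  rw [Metric.isOpen_iff]
  rintro X ⟨σ, hσ, hd⟩
  obtain ⟨_, ⟨x, hx, rfl⟩, hfx⟩ := exists_lt_of_csInf_lt (X.2.1.image f)
    (lt_add_of_pos_right (sInf (f '' X.1)) (show 0 < σ / 4 by positivity))
  obtain ⟨δ, hδ, hδf⟩ := Metric.continuous_iff.1 hfc x (σ / 4) (by positivity)
  refine ⟨min δ (σ / 2), by positivity, fun Y hY => ⟨σ / 2, by positivity, ?_⟩⟩
  have hYX : hausdorffDist Y.1 X.1 < min δ (σ / 2) := hY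
  refine (diam_mono ?_ (isBounded_LsetFun X.2.1 X.2.2.1 f σ)).trans_lt hd
  rintro p ⟨hp1, hp2⟩
  obtain ⟨y, hy, hxy⟩ := exists_dist_lt_of_hausdorffDist_lt' hx
    (hYX.trans_le (min_le_left _ _)) (Y.hausdorffEDist_ne_top X)
  have h1 := csInf_le (hbdd Y.1 Y.2.2.1) (mem_image_of_mem f hy)
  have h2 := (abs_lt.1 (hδf y hxy)).2
  have h3 := infDist_le_infDist_add_hausdorffDist (x := p) (Y.hausdorffEDist_ne_top X)
  have h4 := hYX.trans_le (min_le_right _ _)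
  exact ⟨by linarith, by linarith⟩

theorem isGδ_setOf_revalskiWellPosed {f : E → ℝ} (hfc : Continuous f)
    (hbdd : ∀ S : Set E, IsBounded S → BddBelow (f '' S)) :
    IsGδ {X : Pbclcv E | RevalskiWellPosed X.1 f} := by
  have : {X : Pbclcv E | RevalskiWellPosed X.1 f} =
      ⋂ n : ℕ, {X : Pbclcv E | ∃ σ > 0, diam (LsetFun X.1 f σ) < 1 / ((n : ℝ) + 1)} := by
    ext X
    simp only [mem_ofPred_eq, mem_iInter, revalskiWellPosed_iff]
    refine ⟨fun h n => h _ Nat.one_div_pos_of_nat, fun h η hη => ?_⟩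
    obtain ⟨n, hn⟩ := exists_nat_one_div_lt hη
    obtain ⟨σ, hσ, hd⟩ := h n
    exact ⟨σ, hσ, hd.trans hn⟩
  rw [this]
  exact IsGδ.iInter_of_isOpen fun n => isOpen_exists_diam_LsetFun_lt hfc hbdd _

/-- A point at which a function is smaller than on the `ρ`-neighbourhood of `X` can be moved into
the `2ρ`-neighbourhood. -/
theorem exists_lt_infDist_le_two_mul (hgeo : IsGeodesicSpace E) {f : E → ℝ}
    (hfcv : GeodesicConvexFun f) {X : Set E} (hne : X.Nonempty) (hb : IsBounded X) {ρ : ℝ}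
    (hρ : 0 < ρ) {m : ℝ} (hm : IsGLB (f '' {x | infDist x X ≤ ρ}) m) {z : E} (hz : f z < m) :
    ∃ y, infDist y X ≤ 2 * ρ ∧ f y < m := by
  obtain ⟨B, hB, hBz⟩ := (isBounded_infDist_le hne hb ρ).subset_closedBall_lt ρ z
  have hB0 : 0 < B := hρ.trans hB
  set t := ρ / B with ht
  have ht0 : 0 < t := by positivity
  have ht1 : t ≤ 1 := (div_le_one hB0).2 hB.le
  have hΔ : 0 < m - f z := sub_pos.2 hz
  obtain ⟨_, ⟨u, hu, rfl⟩, -, hfu⟩ := hm.exists_between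
    (lt_add_of_pos_right m (mul_pos ht0 hΔ))
  obtain ⟨c, l, hc, h0, hl⟩ := hgeo.exists_path u z
  have hlB : l ≤ B := by
    have h1 := hc.2 l ⟨hc.1, le_rfl⟩ 0 ⟨le_rfl, hc.1⟩
    have h2 : dist u z ≤ B := hBz hu
    rw [h0, hl, sub_zero, abs_of_nonneg hc.1, dist_comm] at h1
    linarith
  refine ⟨c (t * l), ?_, ?_⟩
  · have h1 := hc.2 _ (mul_mem_Icc_of_mem_unit ⟨ht0.le, ht1⟩ hc.1) 0 ⟨le_rfl, hc.1⟩
    rw [h0, sub_zero, abs_of_nonneg (mul_nonneg ht0.le hc.1)] at h1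
    have h2 := infDist_le_infDist_add_dist (s := X) (x := c (t * l)) (y := u)
    have h3 : t * l ≤ t * B := by gcongr
    have h4 : t * B = ρ := by rw [ht]; field_simp
    have h5 : infDist u X ≤ ρ := hu
    linarith
  · have h1 := hfcv c l hc t ⟨ht0.le, ht1⟩
    rw [h0, hl] at h1
    nlinarith [mul_le_mul_of_nonneg_left hfu.le (sub_nonneg.2 ht1), mul_pos (mul_pos ht0 ht0) hΔ]

/-- The drop-like set with base `X` and vertex `y`; `K` bounds its aperture. -/
def distDrop (X : Set E) (y : E) (K : ℝ) : Set E :=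
  {q | K * infDist q X + dist q y ≤ K * infDist y X}

theorem mul_infDist_add_dist_le_of_infDist_distDrop_le {X : Set E} {y p : E} {K σ : ℝ}
    (hK : 0 ≤ K) (hp : infDist p (distDrop X y K) ≤ σ) :
    K * infDist p X + dist p y ≤ K * infDist y X + (K + 1) * σ := by
  have hy : y ∈ distDrop X y K := by simp [distDrop]
  refine le_of_forall_pos_le_add fun ε hε => ?_
  obtain ⟨q, hq, hpq⟩ := (infDist_lt_iff ⟨y, hy⟩).1
    (hp.trans_lt (lt_add_of_pos_right σ (show 0 < ε / (K + 1) by positivity)))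
  have h1 := infDist_le_infDist_add_dist (s := X) (x := p) (y := q)
  have h2 := dist_triangle p q y
  have h3 : K * infDist q X + dist q y ≤ K * infDist y X := hq
  have h4 : (K + 1) * (ε / (K + 1)) = ε := by field_simp
  nlinarith [mul_le_mul_of_nonneg_left h1 hK]

/-- `min(distDrop X y K, f)` is well-posed as soon as `y` is an Ekeland point of
`f + a * infDist · X` for a small constant on the part below the level of `y`. -/
theorem revalskiWellPosed_distDrop {f : E → ℝ}
    (hbdd : ∀ S : Set E, IsBounded S → BddBelow (f '' S)) {X : Set E} {y : E} {K a : ℝ}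
    (hK : 0 < K) (ha : 0 < a)
    (hy : ∀ q, infDist q X ≤ infDist y X →
      f y + 2 * a * K * infDist y X - a * dist q y ≤ f q + 2 * a * K * infDist q X) :
    RevalskiWellPosed (distDrop X y K) f := by
  have hyY : y ∈ distDrop X y K := by simp [distDrop]
  have hbY : IsBounded (distDrop X y K) := by
    refine (isBounded_closedBall (x := y) (r := K * infDist y X)).subset fun q hq => ?_
    have h1 : K * infDist q X + dist q y ≤ K * infDist y X := hq
    have h2 : 0 ≤ K * infDist q X := mul_nonneg hK.le infDist_nonneg
    exact mem_closedBall.2 (by linarith)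
  refine revalskiWellPosed_of_dist_le y fun η hη => ?_
  refine ⟨a * η / (1 + 2 * a * (K + 1)), by positivity, ?_⟩
  set σ := a * η / (1 + 2 * a * (K + 1)) with hσ
  have hσ0 : 0 < σ := by positivity
  have hση : σ + 2 * a * (K + 1) * σ = a * η := by rw [hσ]; field_simp
  rintro p ⟨hp1, hp2⟩
  have h1 := mul_infDist_add_dist_le_of_infDist_distDrop_le hK.le hp2
  have h2 := csInf_le (hbdd _ hbY) (mem_image_of_mem f hyY)
  refine le_of_mul_le_mul_left ?_ ha
  rcases le_total (infDist p X) (infDist y X) with h | h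
  · nlinarith [hy p h, mul_le_mul_of_nonneg_left h1 ha.le]
  · nlinarith [mul_le_mul_of_nonneg_left h1 ha.le, mul_le_mul_of_nonneg_left h hK.le,
      mul_pos (mul_pos ha (show 0 < K + 1 by positivity)) hσ0,
      mul_le_mul_of_nonneg_left (mul_le_mul_of_nonneg_left h hK.le) ha.le]

/-- If `f` is smaller somewhere than on the `ρ`-neighbourhood of `X`, then `X` can be perturbed
by at most `2ρ` to a set on which minimizing `f` is well-posed. -/
theorem exists_revalskiWellPosed_dist_le [CompleteSpace E] (hgeo : IsGeodesicSpace E)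
    (hconv : HasConvexMetric E) {f : E → ℝ} (hfc : Continuous f) (hfcv : GeodesicConvexFun f)
    (hbdd : ∀ S : Set E, IsBounded S → BddBelow (f '' S)) (X : Pbclcv E) {ρ : ℝ} (hρ : 0 < ρ)
    {z : E} {μ : ℝ} (hzμ : f z < μ) (hμ : ∀ x, infDist x X.1 ≤ ρ → μ ≤ f x) :
    ∃ Y : Pbclcv E, dist Y X ≤ 2 * ρ ∧ RevalskiWellPosed Y.1 f := by
  have hne := X.2.1
  have hbX := X.2.2.1
  obtain ⟨x₀, hx₀⟩ := X.2.1
  have hne' : (f '' {x | infDist x X.1 ≤ ρ}).Nonempty :=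
    ⟨_, mem_image_of_mem f (show infDist x₀ X.1 ≤ ρ by rw [infDist_zero_of_mem hx₀]; exact hρ.le)⟩
  have hm := isGLB_csInf hne' (hbdd _ (isBounded_infDist_le hne hbX ρ))
  set m := sInf (f '' {x | infDist x X.1 ≤ ρ})
  have hzm : f z < m := hzμ.trans_le (hm.2 (by rintro _ ⟨x, hx, rfl⟩; exact hμ x hx))
  obtain ⟨y₀, hy₀, hfy₀⟩ := exists_lt_infDist_le_two_mul hgeo hfcv hne hbX hρ hm hzm
  have hbN := isBounded_infDist_le hne hbX (2 * ρ)
  obtain ⟨D, hD, hDN⟩ : ∃ D > 0, ∀ x ∈ X.1, ∀ q, infDist q X.1 ≤ 2 * ρ → dist x q ≤ D := by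
    refine ⟨diam {x | infDist x X.1 ≤ 2 * ρ} + 1,
      add_pos_of_nonneg_of_pos diam_nonneg one_pos, fun x hx q hq => ?_⟩
    have hx' : infDist x X.1 ≤ 2 * ρ := by rw [infDist_zero_of_mem hx]; positivity
    exact (dist_le_diam_of_mem hbN hx' hq).trans (by linarith)
  set K := D / ρ with hKdef
  have hK : 0 < K := by positivity
  set a := (m - f y₀) / (8 * D) with hadef
  have ha : 0 < a := div_pos (sub_pos.2 hfy₀) (by positivity)
  have haKρ : 8 * (a * K * ρ) = m - f y₀ := by
    rw [hadef, hKdef]; field_simp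
  have hgc : Continuous fun q => f q + 2 * a * K * infDist q X.1 :=
    hfc.add (continuous_const.mul (continuous_infDist_pt _))
  have hgb : BddBelow ((fun q => f q + 2 * a * K * infDist q X.1) ''
      {x | infDist x X.1 ≤ 2 * ρ}) := by
    obtain ⟨b, hb⟩ := hbdd _ hbN
    refine ⟨b, ?_⟩
    rintro _ ⟨q, hq, rfl⟩
    have h1 := hb (mem_image_of_mem f hq)
    have h2 : 0 ≤ 2 * a * K * infDist q X.1 := mul_nonneg (by positivity) infDist_nonneg
    simp only
    linarith
  obtain ⟨y, hyN, hyle, hymin⟩ := exists_ekeland_point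
    (isClosed_le (continuous_infDist_pt X.1) continuous_const) hgc hgb ha hy₀
  have hyN' : infDist y X.1 ≤ 2 * ρ := hyN
  have hρy : ρ ≤ infDist y X.1 := by
    by_contra! hlt
    have h1 : m ≤ f y := hm.1 (mem_image_of_mem f hlt.le)
    have h2 : 0 ≤ 2 * a * K * infDist y X.1 := mul_nonneg (by positivity) infDist_nonneg
    have h3 : 2 * a * K * infDist y₀ X.1 ≤ 2 * a * K * (2 * ρ) := by gcongr
    have h4 : 0 < a * K * ρ := by positivity
    nlinarith
  have hXY : X.1 ⊆ distDrop X.1 y K := by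
    intro x hx
    have h1 : K * ρ = D := by rw [hKdef]; field_simp
    have h2 := mul_le_mul_of_nonneg_left hρy hK.le
    have h3 := hDN x hx y hyN'
    simp only [distDrop, mem_ofPred_eq, infDist_zero_of_mem hx]
    linarith
  have hYX : ∀ q ∈ distDrop X.1 y K, infDist q X.1 ≤ infDist y X.1 := by
    intro q hq
    have h1 : K * infDist q X.1 + dist q y ≤ K * infDist y X.1 := hq
    exact le_of_mul_le_mul_left (by linarith [dist_nonneg (x := q) (y := y)]) hK
  have hYb : IsBounded (distDrop X.1 y K) := hbN.subset fun q hq => (hYX q hq).trans hyN'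
  have hYcl : IsClosed (distDrop X.1 y K) :=
    isClosed_le (by fun_prop) continuous_const
  have hYcv : GeodesicConvex (distDrop X.1 y K) :=
    ((hconv.geodesicConvexFun_infDist hgeo hne X.2.2.2.2).mul_add
      (hconv.geodesicConvexFun_dist y) hK.le).geodesicConvex_sublevel _
  refine ⟨⟨distDrop X.1 y K, hne.mono hXY, hYb, hYcl, hYcv⟩, ?_, ?_⟩
  · refine hausdorffDist_le_of_infDist (by positivity) (fun q hq => (hYX q hq).trans hyN') ?_
    intro x hx
    rw [infDist_zero_of_mem (hXY hx)]
    positivity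
  · exact revalskiWellPosed_distDrop hbdd hK ha fun q hq => hymin q (hq.trans hyN')

/-- Sublevel sets slightly above a strong minimum are small. -/
theorem exists_forall_dist_lt_of_strong_min {f : E → ℝ} {z₀ : E} (hmin : ∀ x, f z₀ ≤ f x)
    (hseq : ∀ x : ℕ → E, Tendsto (fun n => f (x n)) atTop (nhds (f z₀)) → Tendsto x atTop (nhds z₀))
    {η : ℝ} (hη : 0 < η) : ∃ σ > 0, ∀ p, f p ≤ f z₀ + σ → dist p z₀ < η := by
  by_contra! h
  choose x hx hxd using fun n : ℕ => h (1 / ((n : ℝ) + 1)) Nat.one_div_pos_of_nat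
  have hlim : Tendsto (fun n => f (x n)) atTop (nhds (f z₀)) :=
    tendsto_of_tendsto_of_tendsto_of_le_of_le tendsto_const_nhds
      (by simpa using (tendsto_one_div_add_atTop_nhds_zero_nat (𝕜 := ℝ)).const_add (f z₀))
      (fun n => hmin (x n)) hx
  obtain ⟨n, hn⟩ := ((Metric.tendsto_nhds.1 (hseq x hlim)) η hη).exists
  exact (hxd n).not_gt hn

theorem dense_setOf_revalskiWellPosed [CompleteSpace E]
    (hgeo : IsGeodesicSpace E) (hconv : HasConvexMetric E)
    {f : E → ℝ} (hfc : Continuous f) (hfcv : GeodesicConvexFun f)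
    (hbdd : ∀ S : Set E, IsBounded S → BddBelow (f '' S))
    (halt : (¬ BddBelow (Set.range f)) ∨
      ∃ z₀ : E, (∀ x : E, f z₀ ≤ f x) ∧
        ∀ x : ℕ → E, Tendsto (fun n => f (x n)) atTop (nhds (f z₀)) →
          Tendsto x atTop (nhds z₀)) :
    Dense {X : Pbclcv E | RevalskiWellPosed X.1 f} := by
  rw [Metric.dense_iff]
  intro X r hr
  by_cases hX : RevalskiWellPosed X.1 f
  · exact ⟨X, mem_ball_self hr, hX⟩
  suffices h : ∃ ρ > 0, 2 * ρ < r ∧ ∃ z μ, f z < μ ∧ ∀ x, infDist x X.1 ≤ ρ → μ ≤ f x by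
    obtain ⟨ρ, hρ, hρr, z, μ, hz, hμ⟩ := h
    obtain ⟨Y, hY, hYw⟩ := exists_revalskiWellPosed_dist_le hgeo hconv hfc hfcv hbdd X hρ hz hμ
    exact ⟨Y, hY.trans_lt hρr, hYw⟩
  rcases halt with hunb | ⟨z₀, hmin, hseq⟩
  · obtain ⟨μ, hμ⟩ := hbdd _ (isBounded_infDist_le X.2.1 X.2.2.1 (r / 4))
    obtain ⟨_, ⟨z, rfl⟩, hz⟩ := not_bddBelow_iff.1 hunb μ
    exact ⟨r / 4, by positivity, by linarith, z, μ, hz, fun x hx => hμ (mem_image_of_mem f hx)⟩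
  · have hz₀ : z₀ ∉ X.1 := by
      refine fun hmem => hX (revalskiWellPosed_of_dist_le z₀ fun η hη => ?_)
      obtain ⟨σ, hσ, hd⟩ := exists_forall_dist_lt_of_strong_min hmin hseq hη
      refine ⟨σ, hσ, fun p hp => (hd p (hp.1.trans ?_)).le⟩
      gcongr
      exact csInf_le (hbdd _ X.2.2.1) (mem_image_of_mem f hmem)
    have hpos : 0 < infDist z₀ X.1 := (X.2.2.2.1.notMem_iff_infDist_pos X.2.1).1 hz₀
    set ρ := min (r / 4) (infDist z₀ X.1 / 2) with hρdef
    have hρ : 0 < ρ := by positivity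
    have hρr : ρ ≤ r / 4 := min_le_left _ _
    have hρd : ρ ≤ infDist z₀ X.1 / 2 := min_le_right _ _
    obtain ⟨σ, hσ, hd⟩ := exists_forall_dist_lt_of_strong_min hmin hseq hρ
    refine ⟨ρ, hρ, by linarith, z₀, f z₀ + σ, by linarith, fun x hx => ?_⟩
    by_contra! hlt
    have h1 := hd x hlt.le
    have h2 := infDist_le_infDist_add_dist (s := X.1) (x := z₀) (y := x)
    rw [dist_comm] at h2
    linarith

end

/-- the family of sets `X` for which `min(X,f)` is well-posed in the
sense of Revalski is a dense `G_δ`-set in `P_{b,cl,cv}(E)`. -/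
theorem statement16 {E : Type*} [MetricSpace E] [CompleteSpace E]
    (hgeo : IsGeodesicSpace E) (hconv : HasConvexMetric E)
    (f : E → ℝ) (hfc : Continuous f) (hfcv : GeodesicConvexFun f)
    (hbdd : ∀ S : Set E, IsBounded S → BddBelow (f '' S))
    (halt : (¬ BddBelow (Set.range f)) ∨
      ∃ z₀ : E, (∀ x : E, f z₀ ≤ f x) ∧
        ∀ x : ℕ → E, Tendsto (fun n => f (x n)) atTop (nhds (f z₀)) →
          Tendsto x atTop (nhds z₀)) :
    Dense {X : Pbclcv E | RevalskiWellPosed X.1 f} ∧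
    IsGδ {X : Pbclcv E | RevalskiWellPosed X.1 f} := by
  exact ⟨dense_setOf_revalskiWellPosed hgeo hconv hfc hfcv hbdd halt,
    isGδ_setOf_revalskiWellPosed hfc hbdd⟩
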